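/- arXiv:2102.01408 — 6 statements merged into one kernel-verified Lean document; each statement's English description precedes it below -/
import Mathlib

section
/- There exists a universal constant κ > 0 (independent of d and ν) with the following property. Let d ≥ 3, let μ_S be the uniform probability measure on the 2d elements of F_d consisting of the free generators and their inverses, let ν be a probability measure on F_d with ν(e) = 0, and set μ = μ_S * ν (convolution). Let Z_n = g_1 g_2 ⋯ g_n where the g_i are i.i.d. with law μ. Then for all n ≥ 1, P(|Z_n| ≤ κ n) ≤ e^{−κ n}, where |·| denotes word length in F_d with respect to the free generators. -/
open Filter MeasureTheory
open scoped ENNReal NNReal Classical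

noncomputable section

/-- The set of the `2d` free generators of `F_d` and their inverses. -/
def genSet (d : ℕ) : Set (FreeGroup (Fin d)) :=
  {x | ∃ i : Fin d, x = FreeGroup.of i ∨ x = (FreeGroup.of i)⁻¹}

theorem ENNReal.two_mul_le_weighted_sq (x y : ℝ≥0∞) {c : ℝ≥0∞} (h0 : c ≠ 0) (ht : c ≠ ⊤) :
    2 * (x * y) ≤ c * x ^ 2 + c⁻¹ * y ^ 2 := by
  by_cases hx : x = ⊤
  · simp [hx, h0]
  by_cases hy : y = ⊤
  · simp [hy, ht]
  lift x to ℝ≥0 using hx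
  lift y to ℝ≥0 using hy
  lift c to ℝ≥0 using ht
  have hc : c ≠ 0 := by simpa using h0
  rw [← ENNReal.coe_inv hc]
  norm_cast
  rw [← NNReal.coe_le_coe]
  push_cast
  have hc' : (0 : ℝ) < c := by exact_mod_cast pos_iff_ne_zero.2 hc
  have key : (c : ℝ) * x ^ 2 + (c : ℝ)⁻¹ * y ^ 2 - 2 * (x * y) = (c : ℝ)⁻¹ * (c * x - y) ^ 2 := by
    field_simp
    ring
  have := mul_nonneg (inv_nonneg.2 hc'.le) (sq_nonneg ((c : ℝ) * x - y))
  linarith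

/-- Weighted Cauchy–Schwarz inequality for sums in `ℝ≥0∞`. -/
theorem ENNReal.sq_tsum_mul_le {ι : Type*} (p v f : ι → ℝ≥0∞) (h0 : ∀ i, f i ≠ 0)
    (ht : ∀ i, f i ≠ ⊤) :
    (∑' i, p i * v i) ^ 2 ≤ (∑' i, p i * f i) * ∑' i, p i * (v i ^ 2 * (f i)⁻¹) := by
  have h2 : 2 * (∑' i, p i * v i) ^ 2 ≤
      2 * ((∑' i, p i * f i) * ∑' i, p i * (v i ^ 2 * (f i)⁻¹)) := by
    have hswap : ∑' i, ∑' j, (p j * f j) * (p i * (v i ^ 2 * (f i)⁻¹)) =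
        (∑' i, p i * f i) * ∑' i, p i * (v i ^ 2 * (f i)⁻¹) := by
      simp_rw [ENNReal.tsum_mul_right, ENNReal.tsum_mul_left]
    calc 2 * (∑' i, p i * v i) ^ 2
        = ∑' i, ∑' j, p i * p j * (2 * (v i * v j)) := by
          rw [sq, ← ENNReal.tsum_mul_right, ← ENNReal.tsum_mul_left]
          refine tsum_congr fun i => ?_
          rw [← ENNReal.tsum_mul_left, ← ENNReal.tsum_mul_left]
          exact tsum_congr fun j => by ring
      _ ≤ ∑' i, ∑' j, ((p j * f j) * (p i * (v i ^ 2 * (f i)⁻¹))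
            + (p i * f i) * (p j * (v j ^ 2 * (f j)⁻¹))) := by
          refine ENNReal.tsum_le_tsum fun i => ENNReal.tsum_le_tsum fun j => ?_
          have hc := ENNReal.two_mul_le_weighted_sq (v i) (v j) (c := f j * (f i)⁻¹)
            (mul_ne_zero (h0 j) (ENNReal.inv_ne_zero.2 (ht i)))
            (ENNReal.mul_ne_top (ht j) (ENNReal.inv_ne_top.2 (h0 i)))
          rw [ENNReal.mul_inv (Or.inl (h0 j)) (Or.inl (ht j)), inv_inv] at hc
          calc p i * p j * (2 * (v i * v j)) ≤ p i * p j * _ := mul_le_mul_right hc _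
            _ = _ := by ring
      _ = 2 * ((∑' i, p i * f i) * ∑' i, p i * (v i ^ 2 * (f i)⁻¹)) := by
          simp_rw [ENNReal.tsum_add]
          rw [hswap, ENNReal.tsum_comm, hswap, two_mul]
  exact (ENNReal.mul_le_mul_iff_right two_ne_zero ENNReal.ofNat_ne_top).1 h2

section Convolution

variable {G : Type*} [Group G]

/-- The convolution `p * u` of two `ℝ≥0∞`-valued functions on a group. -/
def groupConv (p u : G → ℝ≥0∞) (x : G) : ℝ≥0∞ := ∑' y, p y * u (y⁻¹ * x)

/-- Schur test: a positive function that is `c`-superharmonic for convolution by `p` and by its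
reflection bounds the `ℓ²` norm of convolution by `p`. -/
theorem tsum_groupConv_sq_le (p u f : G → ℝ≥0∞) (c : ℝ≥0∞) (h0 : ∀ x, f x ≠ 0)
    (ht : ∀ x, f x ≠ ⊤) (hl : ∀ x, ∑' y, p y * f (y⁻¹ * x) ≤ c * f x)
    (hr : ∀ x, ∑' y, p y * f (y * x) ≤ c * f x) :
    ∑' x, groupConv p u x ^ 2 ≤ c ^ 2 * ∑' x, u x ^ 2 := by
  calc ∑' x, groupConv p u x ^ 2
      ≤ ∑' x, (c * f x) * ∑' y, p y * (u (y⁻¹ * x) ^ 2 * (f (y⁻¹ * x))⁻¹) := by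
        refine ENNReal.tsum_le_tsum fun x => ?_
        exact (ENNReal.sq_tsum_mul_le p (fun y => u (y⁻¹ * x)) (fun y => f (y⁻¹ * x))
          (fun _ => h0 _) (fun _ => ht _)).trans (mul_le_mul_left (hl x) _)
    _ = ∑' y, ∑' x, (c * f x) * (p y * (u (y⁻¹ * x) ^ 2 * (f (y⁻¹ * x))⁻¹)) := by
        simp_rw [← ENNReal.tsum_mul_left]
        exact ENNReal.tsum_comm
    _ = ∑' y, ∑' x, (c * f (y * x)) * (p y * (u x ^ 2 * (f x)⁻¹)) := by
        refine tsum_congr fun y => ?_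
        rw [← (Equiv.mulLeft y).tsum_eq]
        simp
    _ = ∑' x, c * (u x ^ 2 * (f x)⁻¹) * ∑' y, p y * f (y * x) := by
        rw [ENNReal.tsum_comm]
        refine tsum_congr fun x => ?_
        rw [← ENNReal.tsum_mul_left]
        exact tsum_congr fun y => by ring
    _ ≤ ∑' x, c ^ 2 * u x ^ 2 := by
        refine ENNReal.tsum_le_tsum fun x => ?_
        calc c * (u x ^ 2 * (f x)⁻¹) * ∑' y, p y * f (y * x)
            ≤ c * (u x ^ 2 * (f x)⁻¹) * (c * f x) := mul_le_mul_right (hr x) _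
          _ = c ^ 2 * u x ^ 2 * ((f x)⁻¹ * f x) := by ring
          _ = c ^ 2 * u x ^ 2 := by rw [ENNReal.inv_mul_cancel (h0 x) (ht x), mul_one]
    _ = c ^ 2 * ∑' x, u x ^ 2 := ENNReal.tsum_mul_left

theorem tsum_groupConv_pmf_sq_le (p : PMF G) (u : G → ℝ≥0∞) :
    ∑' x, groupConv p u x ^ 2 ≤ ∑' x, u x ^ 2 := by
  simpa using tsum_groupConv_sq_le p u (fun _ => 1) 1 (by simp) (by simp)
    (by simp [p.tsum_coe]) (by simp [p.tsum_coe])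

theorem groupConv_bind_map_mul (p q : PMF G) (u : G → ℝ≥0∞) :
    groupConv (p.bind fun a => q.map fun h => a * h) u = groupConv p (groupConv q u) := by
  funext x
  simp only [groupConv, PMF.bind_apply, PMF.map_apply, ← ENNReal.tsum_mul_left,
    ← ENNReal.tsum_mul_right]
  rw [ENNReal.tsum_comm]
  refine tsum_congr fun a => ?_
  rw [ENNReal.tsum_comm]
  refine tsum_congr fun h => ?_
  rw [tsum_eq_single (a * h)]
  · simp [mul_assoc]
  · intro y hy
    simp [hy]

/-- The law of the product of `n` independent elements with weights `p`. -/
def convPow (p : G → ℝ≥0∞) (n : ℕ) : G → ℝ≥0∞ :=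
  (groupConv p)^[n] (Pi.single 1 1)

theorem convPow_succ (p : G → ℝ≥0∞) (n : ℕ) :
    convPow p (n + 1) = groupConv p (convPow p n) :=
  Function.iterate_succ_apply' ..

theorem convPow_le_of_contracting (p : G → ℝ≥0∞) (c : ℝ≥0∞)
    (h : ∀ u : G → ℝ≥0∞, ∑' x, groupConv p u x ^ 2 ≤ c ^ 2 * ∑' x, u x ^ 2) (n : ℕ) (x : G) :
    convPow p n x ≤ c ^ n := by
  have hsum : ∑' x, convPow p n x ^ 2 ≤ (c ^ n) ^ 2 := by
    induction n with
    | zero =>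
      rw [tsum_eq_single 1 (fun y hy => by simp [convPow, hy])]
      simp [convPow]
    | succ n ih =>
      rw [convPow_succ]
      calc _ ≤ _ := h _
        _ ≤ c ^ 2 * (c ^ n) ^ 2 := mul_le_mul_right ih _
        _ = _ := by ring
  exact (ENNReal.pow_le_pow_left_iff two_ne_zero).1 ((ENNReal.le_tsum x).trans hsum)

/-- Outer-measure bound for the law of the product of i.i.d. elements of a countable group. -/
theorem measure_prod_eq_le_convPow [Countable G] {Ω : Type*} [MeasurableSpace Ω] (P : Measure Ω)
    (μ : G → ℝ≥0∞) (g : ℕ → Ω → G)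
    (hg : ∀ (m : ℕ) (a : ℕ → G),
      P {ω | ∀ i < m, g i ω = a i} = ∏ i ∈ Finset.range m, μ (a i)) (n : ℕ) (x : G) :
    P {ω | ((List.range n).map fun i => g i ω).prod = x} ≤ convPow μ n x := by
  have key : ∀ (k m : ℕ) (a : ℕ → G) (x : G),
      P {ω | (∀ i < m, g i ω = a i) ∧ ((List.range k).map fun i => g (m + i) ω).prod = x} ≤
        (∏ i ∈ Finset.range m, μ (a i)) * convPow μ k x := by
    intro k
    induction k with
    | zero =>
      intro m a x
      by_cases hx : x = 1
      · simp [hx, convPow, hg]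
      · simp [Ne.symm hx]
    | succ k ih =>
      intro m a x
      have hsub : {ω | (∀ i < m, g i ω = a i) ∧
          ((List.range (k + 1)).map fun i => g (m + i) ω).prod = x} ⊆
          ⋃ y : G, {ω | (∀ i < m + 1, g i ω = Function.update a m y i) ∧
            ((List.range k).map fun i => g (m + 1 + i) ω).prod = y⁻¹ * x} := by
        rintro ω ⟨h1, h2⟩
        refine Set.mem_iUnion.2 ⟨g m ω, fun i hi => ?_, ?_⟩
        · rcases Nat.lt_succ_iff_lt_or_eq.1 hi with h | rfl
          · simp [h.ne, h1 i h]
          · simp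
        · rw [List.range_succ_eq_map] at h2
          simp only [List.map_cons, List.map_map, List.prod_cons, add_zero] at h2
          rw [← h2, inv_mul_cancel_left]
          congr 2
          funext i
          simp [Nat.succ_eq_add_one, add_assoc, add_comm 1 i]
      refine (measure_mono hsub).trans ((measure_iUnion_le _).trans ?_)
      rw [convPow_succ, groupConv, ← ENNReal.tsum_mul_left]
      refine ENNReal.tsum_le_tsum fun y => (ih _ _ _).trans_eq ?_
      rw [Finset.prod_range_succ, Function.update_self, mul_assoc]
      congr 1
      refine Finset.prod_congr rfl fun i hi => ?_
      rw [Function.update_of_ne (Finset.mem_range.1 hi).ne]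
  simpa using key n 0 (fun _ => 1) x

end Convolution

section FreeGroup

variable {α : Type*} [DecidableEq α]

/-- Multiplying by a letter lengthens a reduced word, except for at most one letter, which
shortens it by one. -/
theorem FreeGroup.norm_mk_singleton_mul (x : FreeGroup α) (s : α × Bool) :
    norm (mk [s] * x) = norm x + 1 ∨
      (norm (mk [s] * x) + 1 = norm x ∧ x.toWord.head? = some (s.1, !s.2)) := by
  have h : toWord (mk [s] * x) = reduce (s :: x.toWord) := by
    conv_lhs => rw [← mk_toWord (x := x), mul_mk]
    rfl
  rw [norm, norm, h, reduce.cons, reduce_toWord]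
  rcases hx : x.toWord with _ | ⟨hd, tl⟩
  · simp
  · by_cases hc : s.1 = hd.1 ∧ s.2 = !hd.2
    · right
      obtain ⟨h1, h2⟩ := hc
      simp [h1, h2]
    · left
      simp [hc]

theorem FreeGroup.sum_pow_norm_mk_mul_le [Fintype α] {a : ℝ≥0∞} (h0 : a ≠ 0) (ht : a ≠ ⊤)
    (x : FreeGroup α) :
    ∑ s : α × Bool, a ^ norm (mk [s] * x) ≤ (2 * Fintype.card α * a + a⁻¹) * a ^ norm x := by
  calc ∑ s : α × Bool, a ^ norm (mk [s] * x)
      ≤ ∑ s : α × Bool, (a * a ^ norm x +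
          if x.toWord.head? = some (s.1, !s.2) then a⁻¹ * a ^ norm x else 0) := by
        refine Finset.sum_le_sum fun s _ => ?_
        rcases norm_mk_singleton_mul x s with h | ⟨h, h'⟩
        · rw [h, pow_succ']
          exact le_self_add
        · rw [if_pos h', ← h, pow_succ', ENNReal.inv_mul_cancel_left h0 ht]
          exact le_add_self
    _ ≤ 2 * Fintype.card α * (a * a ^ norm x) + a⁻¹ * a ^ norm x := by
        rw [Finset.sum_add_distrib]
        refine add_le_add (by simp [mul_comm]) ?_
        rcases hx : x.toWord.head? with _ | t
        · simp
        · rw [Finset.sum_eq_single (t.1, !t.2)]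
          · simp
          · rintro ⟨i, b⟩ - hb
            rw [if_neg]
            rintro h
            apply hb
            simp only [Option.some.injEq] at h
            simp [h]
          · simp
    _ = _ := by ring

theorem FreeGroup.encard_norm_le [Fintype α] (r : ℕ) :
    {x : FreeGroup α | norm x ≤ r}.encard ≤ (2 * Fintype.card α + 1) ^ r := by
  let F : FreeGroup α → Fin r → Option (α × Bool) := fun x i => x.toWord[(i : ℕ)]?
  have hF : Set.InjOn F {x | norm x ≤ r} := by
    intro x hx y hy hxy
    apply toWord_injective
    refine List.ext_getElem? fun i => ?_
    by_cases hi : i < r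
    · exact congrFun hxy ⟨i, hi⟩
    · rw [List.getElem?_eq_none, List.getElem?_eq_none]
      · exact hy.trans (not_lt.1 hi)
      · exact hx.trans (not_lt.1 hi)
  rw [← hF.encard_image]
  refine (Set.encard_le_encard (Set.subset_univ _)).trans_eq ?_
  simp [Set.encard_univ, ENat.card_eq_coe_fintype_card, mul_comm]

end FreeGroup

theorem mem_genSet_iff {d : ℕ} {x : FreeGroup (Fin d)} :
    x ∈ genSet d ↔ ∃ s : Fin d × Bool, x = FreeGroup.mk [s] := by
  simp [genSet, FreeGroup.of, FreeGroup.inv_mk, FreeGroup.invRev, or_comm]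

theorem inv_mem_genSet_iff {d : ℕ} {x : FreeGroup (Fin d)} : x⁻¹ ∈ genSet d ↔ x ∈ genSet d := by
  simp [genSet, or_comm, inv_eq_iff_eq_inv]

/-- Convolution by the uniform measure on the generators has `ℓ²` norm at most `2 / √(2d)`. -/
theorem tsum_groupConv_genSet_sq_le {d : ℕ} (μS : FreeGroup (Fin d) → ℝ≥0∞)
    (hμS : ∀ x, μS x = if x ∈ genSet d then ((2 * d : ℝ≥0∞))⁻¹ else 0)
    {a : ℝ≥0∞} (h0 : a ≠ 0) (ht : a ≠ ⊤) (ha : a * a = (2 * d : ℝ≥0∞)⁻¹)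
    (u : FreeGroup (Fin d) → ℝ≥0∞) :
    ∑' x, groupConv μS u x ^ 2 ≤ (2 * a) ^ 2 * ∑' x, u x ^ 2 := by
  have hr : ∀ x, ∑' y, μS y * a ^ (y * x).norm ≤ 2 * a * a ^ x.norm := by
    intro x
    have hle : ∀ y, μS y ≤
        ∑ s : Fin d × Bool, if y = FreeGroup.mk [s] then ((2 * d : ℝ≥0∞))⁻¹ else 0 := by
      intro y
      rw [hμS]
      split_ifs with hy
      · obtain ⟨s, hs⟩ := mem_genSet_iff.1 hy
        exact le_of_eq_of_le (by simp [hs])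
          (Finset.single_le_sum (fun _ _ => zero_le) (Finset.mem_univ s))
      · exact zero_le
    have hd0 : (2 * d : ℝ≥0∞) ≠ 0 := fun h => by
      rw [h, ENNReal.inv_zero] at ha
      exact ENNReal.mul_ne_top ht ht ha
    have hdt : (2 * d : ℝ≥0∞) ≠ ⊤ := ENNReal.mul_ne_top (by simp) (by simp)
    calc ∑' y, μS y * a ^ (y * x).norm
        ≤ ∑' y, ∑ s : Fin d × Bool,
            (if y = FreeGroup.mk [s] then ((2 * d : ℝ≥0∞))⁻¹ else 0) * a ^ (y * x).norm := by
          refine ENNReal.tsum_le_tsum fun y => ?_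
          rw [← Finset.sum_mul]
          exact mul_le_mul_left (hle y) _
      _ = ∑ s : Fin d × Bool, (2 * d : ℝ≥0∞)⁻¹ * a ^ (FreeGroup.mk [s] * x).norm := by
          rw [Summable.tsum_finsetSum fun _ _ => ENNReal.summable]
          refine Finset.sum_congr rfl fun s _ => ?_
          rw [tsum_eq_single (FreeGroup.mk [s]) fun y hy => by simp [hy], if_pos rfl]
      _ ≤ (2 * d : ℝ≥0∞)⁻¹ * ((2 * d * a + a⁻¹) * a ^ x.norm) := by
          rw [← Finset.mul_sum]
          refine mul_le_mul_right ?_ _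
          simpa using FreeGroup.sum_pow_norm_mk_mul_le h0 ht x
      _ = ((2 * d : ℝ≥0∞)⁻¹ * (2 * d) * a + (2 * d : ℝ≥0∞)⁻¹ * a⁻¹) * a ^ x.norm := by ring
      _ = 2 * a * a ^ x.norm := by
          rw [ENNReal.inv_mul_cancel hd0 hdt, ← ha, mul_assoc a a, ENNReal.mul_inv_cancel h0 ht]
          ring
  refine tsum_groupConv_sq_le μS u (fun x => a ^ x.norm) (2 * a) (fun x => pow_ne_zero _ h0)
    (fun x => ENNReal.pow_ne_top ht) (fun x => ?_) hr
  rw [← (Equiv.inv _).tsum_eq]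
  have hinv : ∀ y, μS y⁻¹ = μS y := fun y => by simp only [hμS, inv_mem_genSet_iff]
  simpa [hinv] using hr x

/-- The entropy factor of a ball of radius `n / 20` is beaten by the spectral decay. -/
theorem ball_growth_mul_decay_le {d : ℕ} (hd : 3 ≤ d) (n : ℕ) :
    (2 * d + 1 : ℝ) ^ (⌊(1 / 20 : ℝ) * n⌋₊) * (2 * √(2 * d : ℝ)⁻¹) ^ n ≤
      Real.exp (-(1 / 20) * n) := by
  have hd' : (3 : ℝ) ≤ d := by exact_mod_cast hd
  have hbase : (3 * (2 * d + 1) : ℝ) * (2 * √(2 * d : ℝ)⁻¹) ^ 20 ≤ 1 := by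
    have hs : (2 * √(2 * d : ℝ)⁻¹) ^ 20 = (2 / d : ℝ) ^ 10 := by
      rw [show (20 : ℕ) = 2 * 10 from rfl, pow_mul, mul_pow, Real.sq_sqrt (by positivity)]
      congr 1
      field_simp
    rw [hs, div_pow, mul_div_assoc', div_le_one (by positivity)]
    have h10 : (3 : ℝ) ^ 9 * d ≤ (d : ℝ) ^ 9 * d :=
      mul_le_mul_of_nonneg_right (by gcongr) (by positivity)
    rw [← pow_succ] at h10
    norm_num at h10 ⊢
    linarith
  have hle : (2 * d + 1 : ℝ) ^ ((1 / 20 : ℝ)) * (2 * √(2 * d : ℝ)⁻¹) ≤ Real.exp (-(1 / 20)) := by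
    refine le_of_pow_le_pow_left₀ (n := 20) (by norm_num) (by positivity) ?_
    have h1 : ((2 * d + 1 : ℝ) ^ (1 / 20 : ℝ)) ^ 20 = 2 * d + 1 := by
      rw [← Real.rpow_mul_natCast (by positivity)]
      norm_num
    have h2 : Real.exp (-(1 / 20)) ^ 20 = (Real.exp 1)⁻¹ := by
      rw [← Real.exp_nat_mul, ← Real.exp_neg]
      norm_num
    have he : Real.exp 1 ≤ 3 := by linarith [Real.exp_one_lt_d9]
    rw [mul_pow, h1, h2, ← one_div (Real.exp 1), le_div_iff₀ (Real.exp_pos 1)]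
    calc _ ≤ (2 * d + 1 : ℝ) * (2 * √(2 * d : ℝ)⁻¹) ^ 20 * 3 := by gcongr
      _ = 3 * (2 * d + 1) * (2 * √(2 * d : ℝ)⁻¹) ^ 20 := by ring
      _ ≤ 1 := hbase
  calc (2 * d + 1 : ℝ) ^ (⌊(1 / 20 : ℝ) * n⌋₊) * (2 * √(2 * d : ℝ)⁻¹) ^ n
      ≤ (2 * d + 1 : ℝ) ^ ((1 / 20 : ℝ) * n) * (2 * √(2 * d : ℝ)⁻¹) ^ n := by
        gcongr
        rw [← Real.rpow_natCast]
        exact Real.rpow_le_rpow_of_exponent_le (by linarith) (Nat.floor_le (by positivity))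
    _ = ((2 * d + 1 : ℝ) ^ ((1 / 20 : ℝ)) * (2 * √(2 * d : ℝ)⁻¹)) ^ n := by
        rw [mul_pow (_ ^ _), ← Real.rpow_mul_natCast (by positivity)]
    _ ≤ Real.exp (-(1 / 20)) ^ n := by gcongr
    _ = Real.exp (-(1 / 20) * n) := by rw [← Real.exp_nat_mul, mul_comm]

/-- **Theorem (free group, measures `μ_S * ν` without moment conditions).**
There is a universal `κ > 0`, independent of `d ≥ 3` and of `ν`, such that the walk
driven by `μ = μ_S * ν` satisfies `P(|Z_n| ≤ κ n) ≤ e^{-κ n}`. -/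
theorem free_group_linear_escape :
    ∃ κ : ℝ, 0 < κ ∧
      ∀ (d : ℕ), 3 ≤ d →
      ∀ (μS ν μ : PMF (FreeGroup (Fin d))),
        (∀ x, μS x = if x ∈ genSet d then ((2 * d : ℝ≥0∞))⁻¹ else 0) →
        ν 1 = 0 →
        μ = μS.bind (fun a => ν.map fun h => a * h) →
      ∀ (Ω : Type*) [MeasurableSpace Ω] (P : Measure Ω), IsProbabilityMeasure P →
      ∀ g : ℕ → Ω → FreeGroup (Fin d),
        (∀ (m : ℕ) (a : ℕ → FreeGroup (Fin d)),
          P {ω | ∀ i < m, g i ω = a i} = ∏ i ∈ Finset.range m, μ (a i)) →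
      ∀ n : ℕ, 1 ≤ n →
        P {ω | (FreeGroup.norm (((List.range n).map fun i => g i ω).prod) : ℝ) ≤ κ * n}
          ≤ ENNReal.ofReal (Real.exp (-κ * n)) := by
  refine ⟨1 / 20, by norm_num, ?_⟩
  intro d hd μS ν μ hμS _ hμ Ω _ P _ g hg n _
  have hd0 : (0 : ℝ) < 2 * d := by positivity
  set a : ℝ≥0∞ := ENNReal.ofReal √(2 * d : ℝ)⁻¹ with ha_def
  have ha0 : a ≠ 0 := by
    rw [ha_def, ne_eq, ENNReal.ofReal_eq_zero, not_le]
    positivity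
  have ha : a * a = (2 * d : ℝ≥0∞)⁻¹ := by
    rw [ha_def, ← ENNReal.ofReal_mul (by positivity), Real.mul_self_sqrt (by positivity),
      ENNReal.ofReal_inv_of_pos hd0, ENNReal.ofReal_mul (by norm_num)]
    simp
  have hcontr : ∀ u : FreeGroup (Fin d) → ℝ≥0∞,
      ∑' x, groupConv μ u x ^ 2 ≤ (2 * a) ^ 2 * ∑' x, u x ^ 2 := by
    intro u
    rw [hμ, groupConv_bind_map_mul]
    exact (tsum_groupConv_genSet_sq_le μS hμS ha0 ENNReal.ofReal_ne_top ha _).trans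
      (mul_le_mul_right (tsum_groupConv_pmf_sq_le ν u) _)
  set r : ℕ := ⌊(1 / 20 : ℝ) * n⌋₊
  let B : Set (FreeGroup (Fin d)) := {x | x.norm ≤ r}
  have hB : B.encard ≤ ((2 * d + 1) ^ r : ℕ) := by
    simpa using FreeGroup.encard_norm_le (α := Fin d) r
  have hsub : {ω | (FreeGroup.norm (((List.range n).map fun i => g i ω).prod) : ℝ) ≤ 1 / 20 * n} ⊆
      ⋃ x : B, {ω | ((List.range n).map fun i => g i ω).prod = x} := by
    intro ω hω
    exact Set.mem_iUnion.2 ⟨⟨_, Nat.le_floor hω⟩, rfl⟩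
  calc P {ω | (FreeGroup.norm (((List.range n).map fun i => g i ω).prod) : ℝ) ≤ 1 / 20 * n}
      ≤ ∑' x : B, P {ω | ((List.range n).map fun i => g i ω).prod = x} :=
        (measure_mono hsub).trans (measure_iUnion_le _)
    _ ≤ ∑' _ : B, (2 * a) ^ n := ENNReal.tsum_le_tsum fun x =>
        (measure_prod_eq_le_convPow P μ g hg n x).trans
          (convPow_le_of_contracting μ (2 * a) hcontr n x)
    _ = B.encard * (2 * a) ^ n := ENNReal.tsum_set_const ..
    _ ≤ ((2 * d + 1) ^ r : ℕ) * (2 * a) ^ n := by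
        gcongr
        exact_mod_cast ENat.toENNReal_le.2 hB
    _ = ENNReal.ofReal ((2 * d + 1 : ℝ) ^ r * (2 * √(2 * d : ℝ)⁻¹) ^ n) := by
        rw [ENNReal.ofReal_mul (by positivity), ENNReal.ofReal_pow (by positivity),
          ENNReal.ofReal_pow (by positivity), ENNReal.ofReal_mul (by positivity), ← ha_def,
          ENNReal.ofReal_add (by positivity) (by positivity), ENNReal.ofReal_mul (by positivity)]
        simp
    _ ≤ ENNReal.ofReal (Real.exp (-(1 / 20) * n)) :=
        ENNReal.ofReal_le_ofReal (ball_growth_mul_decay_le hd n)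

end
end

section
/- There exists a universal constant κ > 0 with the following property. For every d ≥ 3, every n ≥ 1, and every choice of nontrivial words w_1, …, w_n ∈ F_d, if s_1, …, s_n are independent random elements, each uniformly distributed on the 2d elements consisting of the free generators of F_d and their inverses, and Z_n = s_1 w_1 s_2 w_2 ⋯ s_n w_n, then P(|Z_n| ≤ κ n) ≤ e^{−κ n}. -/
open Filter MeasureTheory
open scoped ENNReal NNReal Classical

noncomputable section

/-- The element of the free group given by a single letter. -/
def letterElt {d : ℕ} (c : Fin d × Bool) : FreeGroup (Fin d) := FreeGroup.mk [c]

lemma letterElt_inv {d : ℕ} (c : Fin d × Bool) :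
    (letterElt c)⁻¹ = letterElt (c.1, !c.2) := by
  simp [letterElt, FreeGroup.inv_mk, FreeGroup.invRev]

lemma sum_letterElt_inv {d : ℕ} (F : FreeGroup (Fin d) → ℝ≥0) :
    ∑ c, F (letterElt c)⁻¹ = ∑ c, F (letterElt c) := by
  simp only [letterElt_inv]
  exact ((Equiv.refl (Fin d)).prodCongr Equiv.boolNot).sum_comp fun c => F (letterElt c)

lemma exists_letterElt_of_mem_genSet {d : ℕ} {v : FreeGroup (Fin d)} (hv : v ∈ genSet d) :
    ∃ c, v = letterElt c := by
  obtain ⟨i, rfl | rfl⟩ := hv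
  · exact ⟨(i, true), rfl⟩
  · exact ⟨(i, false), letterElt_inv (i, true)⟩

lemma letterElt_mem_genSet {d : ℕ} (c : Fin d × Bool) : letterElt c ∈ genSet d := by
  obtain ⟨i, b⟩ := c
  refine ⟨i, ?_⟩
  cases b
  · exact Or.inr (letterElt_inv (i, true)).symm
  · exact Or.inl rfl

/-- Multiplying on the left by a letter lengthens a word, except for at most one letter,
which shortens it by at most one. -/
lemma exists_letter_norm_mul {d : ℕ} (hd : 0 < d) (g : FreeGroup (Fin d)) :
    ∃ c₀ : Fin d × Bool, ∀ c, g.norm ≤ (letterElt c * g).norm + 1 ∧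
      (c ≠ c₀ → g.norm + 1 ≤ (letterElt c * g).norm) := by
  have key : ∀ c : Fin d × Bool, (letterElt c * g).toWord = FreeGroup.reduce (c :: g.toWord) := by
    intro c
    conv_lhs => rw [← FreeGroup.mk_toWord (x := g)]
    rw [letterElt, FreeGroup.mul_mk, FreeGroup.toWord_mk]
    rfl
  have hred := FreeGroup.reduce_toWord g
  rcases hg : g.toWord with _ | ⟨b, l⟩
  · refine ⟨(⟨0, hd⟩, true), fun c => ?_⟩
    simp [FreeGroup.norm, key, hg]
  · refine ⟨(b.1, !b.2), fun c => ?_⟩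
    rw [hg] at hred
    simp only [FreeGroup.norm, key, hg, FreeGroup.reduce.cons c, hred]
    split_ifs with h
    · refine ⟨by simp, fun hc => (hc ?_).elim⟩
      exact Prod.ext h.1 h.2
    · simp

lemma sum_pow_norm_letterElt_mul_le {d : ℕ} (hd : 0 < d) (x : ℝ≥0) (hx0 : 0 < x) (hx1 : x ≤ 1)
    (g : FreeGroup (Fin d)) :
    ∑ c : Fin d × Bool, x ^ (letterElt c * g).norm
      ≤ (x⁻¹ + ((2 * d - 1 : ℕ) : ℝ≥0) * x) * x ^ g.norm := by
  obtain ⟨c₀, hc₀⟩ := exists_letter_norm_mul hd g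
  rw [← Finset.add_sum_erase _ _ (Finset.mem_univ c₀), add_mul]
  refine add_le_add ?_ ?_
  · rw [inv_mul_eq_div, le_div_iff₀ hx0, ← pow_succ]
    exact pow_le_pow_of_le_one zero_le hx1 (hc₀ c₀).1
  · refine (Finset.sum_le_card_nsmul _ _ (x ^ (g.norm + 1)) ?_).trans ?_
    · intro c hc
      exact pow_le_pow_of_le_one zero_le hx1 ((hc₀ c).2 (Finset.ne_of_mem_erase hc))
    · rw [Finset.card_erase_of_mem (Finset.mem_univ _), nsmul_eq_mul]
      simp only [Finset.card_univ, Fintype.card_prod, Fintype.card_fin, Fintype.card_bool]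
      rw [pow_succ, mul_comm d 2, mul_assoc, mul_comm x]

/-- The squared `ℓ²` norm. -/
def sqNorm {G : Type*} (f : G → ℝ≥0) : ℝ≥0∞ := ∑' g, ((f g ^ 2 : ℝ≥0) : ℝ≥0∞)

lemma sqNorm_comp_mul_left {G : Type*} [Group G] (f : G → ℝ≥0) (a : G) :
    sqNorm (fun g => f (a * g)) = sqNorm f :=
  (Equiv.mulLeft a).tsum_eq fun g => ((f g ^ 2 : ℝ≥0) : ℝ≥0∞)

/-- **Schur test** for the adjacency operator of the Cayley graph of a free group. -/
lemma sqNorm_sum_letterElt_mul_le {d : ℕ} (hd : 0 < d) (x : ℝ≥0) (hx0 : 0 < x) (hx1 : x ≤ 1)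
    (f : FreeGroup (Fin d) → ℝ≥0) :
    sqNorm (fun g => ∑ c, f (letterElt c * g))
      ≤ (((x⁻¹ + ((2 * d - 1 : ℕ) : ℝ≥0) * x) ^ 2 : ℝ≥0) : ℝ≥0∞) * sqNorm f := by
  set C : ℝ≥0 := x⁻¹ + ((2 * d - 1 : ℕ) : ℝ≥0) * x
  set h : FreeGroup (Fin d) → ℝ≥0 := fun g => x ^ g.norm
  have hpos : ∀ g, 0 < h g := fun g => pow_pos hx0 _
  have hsum : ∀ g, ∑ c, h (letterElt c * g) ≤ C * h g :=
    sum_pow_norm_letterElt_mul_le hd x hx0 hx1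
  have hsum' : ∀ g, ∑ c, h ((letterElt c)⁻¹ * g) ≤ C * h g := fun g =>
    (sum_letterElt_inv fun v => h (v * g)).trans_le (hsum g)
  have hpt : ∀ g, (∑ c, f (letterElt c * g)) ^ 2
      ≤ ∑ c, C * h g * (f (letterElt c * g) ^ 2 / h (letterElt c * g)) := by
    intro g
    rw [← Finset.mul_sum]
    refine (Finset.sum_sq_le_sum_mul_sum_of_sq_le_mul (R := ℝ≥0) _
      (f := fun c => h (letterElt c * g))
      (g := fun c => f (letterElt c * g) ^ 2 / h (letterElt c * g)) (fun _ _ => zero_le)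
      (fun _ _ => zero_le) (fun c _ => ?_)).trans ?_
    · exact (mul_div_cancel₀ _ (hpos _).ne').ge
    · exact mul_le_mul_left (hsum g) _
  calc sqNorm (fun g => ∑ c, f (letterElt c * g))
      ≤ ∑' g, ∑ c, ((C * h g * (f (letterElt c * g) ^ 2 / h (letterElt c * g)) : ℝ≥0) : ℝ≥0∞) := by
        refine ENNReal.tsum_le_tsum fun g => ?_
        rw [← ENNReal.ofNNReal_finsetSum]
        exact ENNReal.coe_le_coe.2 (hpt g)
    _ = ∑ c, ∑' g, ((C * h g * (f (letterElt c * g) ^ 2 / h (letterElt c * g)) : ℝ≥0) : ℝ≥0∞) :=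
        Summable.tsum_finsetSum fun _ _ => ENNReal.summable
    _ = ∑ c, ∑' g, ((C * h ((letterElt c)⁻¹ * g) * (f g ^ 2 / h g) : ℝ≥0) : ℝ≥0∞) := by
        refine Finset.sum_congr rfl fun c _ => ?_
        rw [← (Equiv.mulLeft (letterElt c)).tsum_eq
          fun g => ((C * h ((letterElt c)⁻¹ * g) * (f g ^ 2 / h g) : ℝ≥0) : ℝ≥0∞)]
        simp only [Equiv.coe_mulLeft, inv_mul_cancel_left]
    _ = ∑' g, ∑ c, ((C * h ((letterElt c)⁻¹ * g) * (f g ^ 2 / h g) : ℝ≥0) : ℝ≥0∞) :=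
        (Summable.tsum_finsetSum fun _ _ => ENNReal.summable).symm
    _ ≤ ∑' g, ((C ^ 2 : ℝ≥0) : ℝ≥0∞) * ((f g ^ 2 : ℝ≥0) : ℝ≥0∞) := by
        refine ENNReal.tsum_le_tsum fun g => ?_
        rw [← ENNReal.ofNNReal_finsetSum, ← ENNReal.coe_mul, ENNReal.coe_le_coe,
          ← Finset.sum_mul, ← Finset.mul_sum]
        calc C * (∑ c, h ((letterElt c)⁻¹ * g)) * (f g ^ 2 / h g)
            ≤ C * (C * h g) * (f g ^ 2 / h g) := by gcongr; exact hsum' g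
          _ = C ^ 2 * f g ^ 2 := by have := (hpos g).ne'; field_simp
    _ = _ := ENNReal.tsum_mul_left

/-- The number of sequences of `n` letters `c₀, …` with `c₀ w₀ ⋯ cₙ₋₁ wₙ₋₁ = g`. -/
def interspersedCount {d : ℕ} : ℕ → (ℕ → FreeGroup (Fin d)) → FreeGroup (Fin d) → ℝ≥0
  | 0, _, g => if g = 1 then 1 else 0
  | n + 1, w, g => ∑ c, interspersedCount n (fun i => w (i + 1)) ((letterElt c * w 0)⁻¹ * g)

lemma sqNorm_interspersedCount_le {d : ℕ} (hd : 0 < d) (x : ℝ≥0) (hx0 : 0 < x) (hx1 : x ≤ 1)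
    (n : ℕ) (w : ℕ → FreeGroup (Fin d)) :
    sqNorm (interspersedCount n w)
      ≤ (((x⁻¹ + ((2 * d - 1 : ℕ) : ℝ≥0) * x) ^ 2 : ℝ≥0) : ℝ≥0∞) ^ n := by
  induction n generalizing w with
  | zero =>
    rw [sqNorm, tsum_eq_single 1]
    · simp [interspersedCount]
    · intro g hg
      simp [interspersedCount, hg]
  | succ n ih =>
    set f : FreeGroup (Fin d) → ℝ≥0 :=
      fun g => interspersedCount n (fun i => w (i + 1)) ((w 0)⁻¹ * g) with hf
    have h : interspersedCount (n + 1) w = fun g => ∑ c, f (letterElt c * g) := by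
      funext g
      simp only [hf, interspersedCount, mul_inv_rev, mul_assoc]
      exact sum_letterElt_inv
        fun v => interspersedCount n (fun i => w (i + 1)) ((w 0)⁻¹ * (v * g))
    have hfn : sqNorm f = sqNorm (interspersedCount n fun i => w (i + 1)) :=
      sqNorm_comp_mul_left (interspersedCount n fun i => w (i + 1)) (w 0)⁻¹
    have hstep := sqNorm_sum_letterElt_mul_le hd x hx0 hx1 f
    rw [h, pow_succ']
    generalize (((x⁻¹ + ((2 * d - 1 : ℕ) : ℝ≥0) * x) ^ 2 : ℝ≥0) : ℝ≥0∞) = K at ih hstep ⊢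
    rw [hfn] at hstep
    exact hstep.trans (mul_le_mul_right (ih _) _)

instance {d : ℕ} : Countable (FreeGroup (Fin d)) :=
  FreeGroup.toWord_injective.countable

/-- The joint law of the first generators and of the product of the following factors. -/
lemma measure_initial_prod_eq_le {d : ℕ} (w : ℕ → FreeGroup (Fin d)) {Ω : Type*}
    [MeasurableSpace Ω] (P : Measure Ω) (s : ℕ → Ω → FreeGroup (Fin d))
    (hs : ∀ (m : ℕ) (a : ℕ → FreeGroup (Fin d)),
      P {ω | ∀ i < m, s i ω = a i} =
        ∏ i ∈ Finset.range m, if a i ∈ genSet d then ((2 * d : ℝ≥0∞))⁻¹ else 0)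
    (n m : ℕ) (a : ℕ → FreeGroup (Fin d)) (ha : ∀ i < m, a i ∈ genSet d)
    (g : FreeGroup (Fin d)) :
    P {ω | (∀ i < m, s i ω = a i) ∧
        ((List.range n).map fun i => s (m + i) ω * w (m + i)).prod = g}
      ≤ ((2 * d : ℝ≥0∞))⁻¹ ^ (m + n) * interspersedCount n (fun i => w (m + i)) g := by
  induction n generalizing m a g with
  | zero =>
    by_cases hg : g = 1
    · refine (measure_mono (t := {ω | ∀ i < m, s i ω = a i}) fun ω hω => hω.1).trans ?_
      rw [hs m a, Finset.prod_congr rfl fun i hi => if_pos (ha i (Finset.mem_range.1 hi))]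
      simp [interspersedCount, hg]
    · simp [interspersedCount, hg, Ne.symm hg]
  | succ n ih =>
    set u : FreeGroup (Fin d) → ℕ → FreeGroup (Fin d) := Function.update a m
    set A : FreeGroup (Fin d) → Set Ω := fun v => {ω | (∀ i < m + 1, s i ω = u v i) ∧
      ((List.range n).map fun i => s (m + 1 + i) ω * w (m + 1 + i)).prod
        = (v * w m)⁻¹ * g}
    have hlt : ∀ v, ∀ i < m, u v i = a i := fun v i hi => Function.update_of_ne hi.ne _ _
    have hm : ∀ v, u v m = v := fun v => Function.update_self _ _ _
    have hnull : ∀ v ∉ genSet d, P (A v) = 0 := by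
      intro v hv
      refine measure_mono_null (fun ω hω => hω.1) ((hs (m + 1) (u v)).trans ?_)
      exact Finset.prod_eq_zero (Finset.self_mem_range_succ m) (by rw [hm, if_neg hv])
    have hsub : {ω | (∀ i < m, s i ω = a i) ∧
        ((List.range (n + 1)).map fun i => s (m + i) ω * w (m + i)).prod = g}
        ⊆ (⋃ c, A (letterElt c)) ∪ ⋃ v ∈ (genSet d)ᶜ, A v := by
      rintro ω ⟨h1, h2⟩
      have hω : ω ∈ A (s m ω) := by
        refine ⟨fun i hi => ?_, ?_⟩
        · rcases Nat.lt_succ_iff_lt_or_eq.1 hi with hi | rfl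
          · rw [hlt _ i hi, h1 i hi]
          · rw [hm]
        · rw [List.range_succ_eq_map, List.map_cons, List.prod_cons, List.map_map] at h2
          rw [← h2]
          simp only [add_zero, inv_mul_cancel_left]
          congr 2
          funext i
          simp [add_assoc, add_comm 1 i]
      by_cases hv : s m ω ∈ genSet d
      · obtain ⟨c, hc⟩ := exists_letterElt_of_mem_genSet hv
        exact Or.inl (Set.mem_iUnion.2 ⟨c, hc ▸ hω⟩)
      · exact Or.inr (Set.mem_biUnion hv hω)
    have hnull' : P (⋃ v ∈ (genSet d)ᶜ, A v) = 0 :=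
      (measure_biUnion_null_iff (Set.to_countable _)).2 hnull
    refine (measure_mono hsub).trans ((measure_union_le _ _).trans ?_)
    rw [hnull', add_zero]
    refine (measure_iUnion_fintype_le P _).trans ?_
    rw [interspersedCount, ENNReal.ofNNReal_finsetSum, Finset.mul_sum]
    refine Finset.sum_le_sum fun c _ => ?_
    have hgen : ∀ i < m + 1, u (letterElt c) i ∈ genSet d := by
      intro i hi
      rcases Nat.lt_succ_iff_lt_or_eq.1 hi with hi | rfl
      · rw [hlt _ i hi]; exact ha i hi
      · rw [hm]; exact letterElt_mem_genSet c
    refine (ih (m + 1) _ hgen _).trans (le_of_eq ?_)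
    have hw : (fun i => w (m + 1 + i)) = fun i => w (m + (i + 1)) := by
      funext i; congr 1; omega
    rw [hw, add_right_comm, add_assoc m n 1, add_zero]

/-- Words of norm at most `r` inject into sequences of `r` optional letters. -/
lemma exists_finset_norm_le {d : ℕ} (r : ℕ) :
    ∃ B : Finset (FreeGroup (Fin d)), (∀ g, g ∈ B ↔ g.norm ≤ r) ∧ B.card ≤ (2 * d + 1) ^ r := by
  let φ : FreeGroup (Fin d) → (Fin r → Option (Fin d × Bool)) := fun g i => g.toWord[(i : ℕ)]?
  have hinj : Set.InjOn φ {g | g.norm ≤ r} := by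
    intro g hg h hh hgh
    apply FreeGroup.toWord_injective
    apply List.ext_getElem?
    intro i
    by_cases hi : i < r
    · exact congrFun hgh ⟨i, hi⟩
    · have h1 : g.toWord.length ≤ r := hg
      have h2 : h.toWord.length ≤ r := hh
      rw [List.getElem?_eq_none (by omega), List.getElem?_eq_none (by omega)]
  have hfin : {g : FreeGroup (Fin d) | g.norm ≤ r}.Finite :=
    Set.Finite.of_finite_image (Set.toFinite _) hinj
  refine ⟨hfin.toFinset, fun g => by simp, ?_⟩
  refine (Finset.card_le_card_of_injOn φ (t := Finset.univ) (fun _ _ => Finset.mem_univ _)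
    (by simpa using hinj)).trans ?_
  simp [mul_comm]

lemma sq_sum_interspersedCount_le {d : ℕ} (hd : 0 < d) (n : ℕ) (w : ℕ → FreeGroup (Fin d))
    (B : Finset (FreeGroup (Fin d))) :
    (∑ g ∈ B, interspersedCount n w g) ^ 2
      ≤ (B.card : ℝ≥0) * (4 * ((2 * d - 1 : ℕ) : ℝ≥0)) ^ n := by
  have hq1 : (1 : ℝ≥0) ≤ ((2 * d - 1 : ℕ) : ℝ≥0) := by
    exact_mod_cast (by omega : 1 ≤ 2 * d - 1)
  set q : ℝ≥0 := ((2 * d - 1 : ℕ) : ℝ≥0) with hq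
  have hr1 : 1 ≤ NNReal.sqrt q := by simpa using NNReal.sqrt_le_sqrt.2 hq1
  have hr0 : 0 < NNReal.sqrt q := zero_lt_one.trans_le hr1
  have h := sqNorm_interspersedCount_le hd (NNReal.sqrt q)⁻¹ (inv_pos.2 hr0)
    (inv_le_one_of_one_le₀ hr1) n w
  have hC : ((NNReal.sqrt q)⁻¹⁻¹ + q * (NNReal.sqrt q)⁻¹) ^ 2 = 4 * q := by
    have h2 : q * (NNReal.sqrt q)⁻¹ = NNReal.sqrt q := by
      rw [← div_eq_mul_inv, div_eq_iff hr0.ne', NNReal.mul_self_sqrt]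
    rw [inv_inv, h2, ← two_mul, mul_pow, NNReal.sq_sqrt]
    norm_num
  rw [← hq, hC] at h
  have hB : ∑ g ∈ B, interspersedCount n w g ^ 2 ≤ (4 * q) ^ n := by
    rw [← ENNReal.coe_le_coe, ENNReal.ofNNReal_finsetSum, ENNReal.coe_pow]
    exact (ENNReal.sum_le_tsum B).trans h
  exact sq_sum_le_card_mul_sum_sq.trans (mul_le_mul_right hB _)

lemma ball_growth_mul_spectral_le {d n r : ℕ} (hd : 3 ≤ d) (hr : 8 * r ≤ n) :
    ((2 * d + 1 : ℝ)) ^ r * (4 * (2 * d - 1)) ^ n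
      ≤ ((2 * d : ℝ) ^ n * Real.exp (-(1 / 8) * n)) ^ 2 := by
  have hd' : (3 : ℝ) ≤ d := by exact_mod_cast hd
  have he : Real.exp 2 ≤ 8 := by
    have h1 : Real.exp 2 = Real.exp 1 ^ 2 := by rw [← Real.exp_nat_mul]; norm_num
    have h2 := Real.exp_one_lt_d9
    rw [h1]
    nlinarith [Real.exp_pos 1]
  have hbase : (2 * d + 1 : ℝ) * (4 * (2 * d - 1)) ^ 8 ≤ (2 * d : ℝ) ^ 16 * Real.exp (-2) := by
    have hq : (0 : ℝ) < 2 * d - 1 := by linarith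
    set y : ℝ := d ^ 2 / (2 * d - 1) with hy
    have hyq : y * (2 * d - 1) = d ^ 2 := div_mul_cancel₀ _ hq.ne'
    have hy1 : 9 / 5 ≤ y := by rw [hy, le_div_iff₀ hq]; nlinarith
    have hy2 : (d : ℝ) ≤ 2 * y := by
      have : (d : ℝ) / 2 ≤ y := by rw [hy, le_div_iff₀ hq]; nlinarith
      linarith
    have hy7 : (40 : ℝ) ≤ y ^ 7 :=
      le_trans (by norm_num) (pow_le_pow_left₀ (by norm_num) hy1 7)
    have h1 : (2 * d + 1 : ℝ) * 8 ≤ y ^ 8 := by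
      have : y ^ 8 = y ^ 7 * y := by ring
      nlinarith
    have h16 : (2 * d : ℝ) ^ 16 = y ^ 8 * (4 * (2 * d - 1)) ^ 8 := by
      rw [← mul_pow, show y * (4 * (2 * d - 1)) = 4 * (y * (2 * (d : ℝ) - 1)) by ring, hyq]
      ring
    rw [Real.exp_neg, ← div_eq_mul_inv, le_div_iff₀ (Real.exp_pos 2), h16]
    have hp : (0 : ℝ) ≤ (4 * (2 * d - 1)) ^ 8 := by positivity
    calc (2 * d + 1 : ℝ) * (4 * (2 * d - 1)) ^ 8 * Real.exp 2
        ≤ (2 * d + 1 : ℝ) * (4 * (2 * d - 1)) ^ 8 * 8 := by gcongr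
      _ = ((2 * d + 1 : ℝ) * 8) * (4 * (2 * d - 1)) ^ 8 := by ring
      _ ≤ _ := by gcongr
  have hq : (0 : ℝ) ≤ 4 * (2 * d - 1) := by linarith
  refine le_of_pow_le_pow_left₀ (n := 8) (by norm_num) (by positivity) ?_
  generalize (4 * (2 * d - 1) : ℝ) = q at hq hbase ⊢
  calc ((2 * d + 1 : ℝ) ^ r * q ^ n) ^ 8
      = (2 * d + 1 : ℝ) ^ (8 * r) * (q ^ 8) ^ n := by ring
    _ ≤ (2 * d + 1 : ℝ) ^ n * (q ^ 8) ^ n := by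
        gcongr
        linarith
    _ = ((2 * d + 1 : ℝ) * q ^ 8) ^ n := (mul_pow _ _ _).symm
    _ ≤ ((2 * d : ℝ) ^ 16 * Real.exp (-2)) ^ n := by gcongr
    _ = (((2 * d : ℝ) ^ n * Real.exp (-(1 / 8) * n)) ^ 2) ^ 8 := by
        have h : Real.exp (-2) ^ n = Real.exp (-(1 / 8) * n) ^ 16 := by
          rw [← Real.exp_nat_mul, ← Real.exp_nat_mul]
          congr 1
          push_cast
          ring
        rw [mul_pow, h]
        generalize (2 * d : ℝ) = z
        ring

/-- **Lemma (free group, prescribed words interspersed with uniform generators).** -/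
theorem free_group_interspersed_linear_escape :
    ∃ κ : ℝ, 0 < κ ∧
      ∀ (d : ℕ), 3 ≤ d → ∀ (n : ℕ), 1 ≤ n →
      ∀ w : ℕ → FreeGroup (Fin d), (∀ i < n, w i ≠ 1) →
      ∀ (Ω : Type*) [MeasurableSpace Ω] (P : Measure Ω), IsProbabilityMeasure P →
      ∀ s : ℕ → Ω → FreeGroup (Fin d),
        (∀ (m : ℕ) (a : ℕ → FreeGroup (Fin d)),
          P {ω | ∀ i < m, s i ω = a i} =
            ∏ i ∈ Finset.range m, if a i ∈ genSet d then ((2 * d : ℝ≥0∞))⁻¹ else 0) →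
        P {ω | (FreeGroup.norm (((List.range n).map fun i => s i ω * w i).prod) : ℝ) ≤ κ * n}
          ≤ ENNReal.ofReal (Real.exp (-κ * n)) := by
  refine ⟨1 / 8, by norm_num, ?_⟩
  intro d hd n _ w _ Ω _ P _ s hs
  obtain ⟨B, hB, hcard⟩ := exists_finset_norm_le (d := d) (n / 8)
  have hpoint : ∀ g, P {ω | ((List.range n).map fun i => s i ω * w i).prod = g}
      ≤ ((2 * d : ℝ≥0∞))⁻¹ ^ n * interspersedCount n w g := by
    intro g
    simpa using measure_initial_prod_eq_le w P s hs n 0 1 (by simp) g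
  have hsub : {ω | (FreeGroup.norm (((List.range n).map fun i => s i ω * w i).prod) : ℝ)
      ≤ 1 / 8 * n} ⊆ ⋃ g ∈ B, {ω | ((List.range n).map fun i => s i ω * w i).prod = g} := by
    intro ω hω
    refine Set.mem_biUnion (Finset.mem_coe.2 ((hB _).2 ?_)) rfl
    rw [Nat.le_div_iff_mul_le (by norm_num)]
    have h : (FreeGroup.norm (((List.range n).map fun i => s i ω * w i).prod) : ℝ)
      ≤ 1 / 8 * n := hω
    have h' : (FreeGroup.norm (((List.range n).map fun i => s i ω * w i).prod) : ℝ) * 8 ≤ n := by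
      linarith
    exact_mod_cast h'
  set S : ℝ≥0 := ∑ g ∈ B, interspersedCount n w g
  have hSle : (S : ℝ) ≤ (2 * d : ℝ) ^ n * Real.exp (-(1 / 8) * n) := by
    refine le_of_sq_le_sq ?_ (by positivity)
    refine le_trans ?_ (ball_growth_mul_spectral_le hd (r := n / 8) (n := n) (by omega))
    have h1 : (S : ℝ) ^ 2 ≤ (B.card : ℝ) * (4 * ((2 * d - 1 : ℕ) : ℝ)) ^ n := by
      exact_mod_cast sq_sum_interspersedCount_le (by omega) n w B
    rw [Nat.cast_sub (by omega)] at h1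
    push_cast at h1
    have h2 : (B.card : ℝ) ≤ (2 * d + 1 : ℝ) ^ (n / 8) := by exact_mod_cast hcard
    have h3 : (0 : ℝ) ≤ 2 * d - 1 := by
      have : (3 : ℝ) ≤ d := by exact_mod_cast hd
      linarith
    exact h1.trans (mul_le_mul_of_nonneg_right h2 (by positivity))
  calc _ ≤ ∑ g ∈ B, P {ω | ((List.range n).map fun i => s i ω * w i).prod = g} :=
        (measure_mono hsub).trans (measure_biUnion_finset_le _ _)
    _ ≤ ∑ g ∈ B, ((2 * d : ℝ≥0∞))⁻¹ ^ n * interspersedCount n w g :=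
        Finset.sum_le_sum fun g _ => hpoint g
    _ = (S : ℝ≥0∞) / (2 * d : ℝ≥0∞) ^ n := by
        rw [← Finset.mul_sum, ← ENNReal.ofNNReal_finsetSum, ← ENNReal.inv_pow, mul_comm,
          div_eq_mul_inv]
    _ ≤ ENNReal.ofReal (Real.exp (-(1 / 8) * n)) := by
        have h2d : (2 * d : ℝ≥0∞) ^ n = ENNReal.ofReal ((2 * d : ℝ) ^ n) := by
          rw [ENNReal.ofReal_pow (by positivity), ENNReal.ofReal_mul (by norm_num)]
          simp
        refine ENNReal.div_le_of_le_mul' ?_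
        rw [h2d, ← ENNReal.ofReal_mul (by positivity), ← ENNReal.ofReal_coe_nnreal]
        exact ENNReal.ofReal_le_ofReal hSle

end
end

section
/- Let X be a δ-hyperbolic metric space, let C ≥ 0, and let w, x, y, z ∈ X satisfy (w,y)_x ≤ C, (x,z)_y ≤ C + δ, and d(x,y) ≥ 2C + 2δ + 1. Then (w,z)_x ≤ C + δ. -/
open Filter MeasureTheory
open scoped ENNReal NNReal Classical

noncomputable section

/-- The Gromov product `(x,z)_a`. -/
def gromov {X : Type*} [MetricSpace X] (x z a : X) : ℝ :=
  (dist a x + dist a z - dist x z) / 2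

/-- `X` is `δ`-hyperbolic. -/
def IsDeltaHyperbolic (X : Type*) [MetricSpace X] (δ : ℝ) : Prop :=
  ∀ x y z a : X, min (gromov x y a) (gromov y z a) - δ ≤ gromov x z a

/-- An isometry `g` of `X` is loxodromic: `d(o, g^n o)/n` converges to a positive limit. -/
def Loxodromic {X : Type*} [MetricSpace X] (o : X) (g : X ≃ᵢ X) : Prop :=
  ∃ L : ℝ, 0 < L ∧ Tendsto (fun n : ℕ => dist o ((g ^ n) o) / n) atTop (nhds L)

/-- Two isometries have disjoint fixed point sets at infinity:
for all signs `ε, ε' ∈ {1, -1}`, `sup_{n,m ≥ 1} (u^{εn}·o, v^{ε'm}·o)_o < ∞`. -/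
def DisjointFixedPointsAtInfinity {X : Type*} [MetricSpace X] (o : X) (u v : X ≃ᵢ X) : Prop :=
  ∀ ε ε' : ℤ, (ε = 1 ∨ ε = -1) → (ε' = 1 ∨ ε' = -1) →
    ∃ B : ℝ, ∀ n m : ℕ, 1 ≤ n → 1 ≤ m →
      gromov ((u ^ (ε * (n : ℤ))) o) ((v ^ (ε' * (m : ℤ))) o) o ≤ B

/-- A (discrete) probability measure on the isometry group of `X` is non-elementary if
the semigroup generated by its support contains two loxodromic elements with disjoint
fixed point sets at infinity. -/
def NonElementary {X : Type*} [MetricSpace X] (o : X) (μ : PMF (X ≃ᵢ X)) : Prop :=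
  ∃ u v : X ≃ᵢ X,
    u ∈ Subsemigroup.closure μ.support ∧ v ∈ Subsemigroup.closure μ.support ∧
      Loxodromic o u ∧ Loxodromic o v ∧ DisjointFixedPointsAtInfinity o u v

/-- The random walk `Z_n = g_0 g_1 ⋯ g_{n-1}`. -/
def RW {G : Type*} [Group G] {Ω : Type*} (g : ℕ → Ω → G) (n : ℕ) (ω : Ω) : G :=
  ((List.range n).map fun i => g i ω).prod

/-- The increments `g_i` are i.i.d. with (discrete) law `μ`: the cylinder events have
the product probabilities. -/
def IsIIDWalk {G Ω : Type*} [MeasurableSpace Ω] (P : Measure Ω) (μ : PMF G)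
    (g : ℕ → Ω → G) : Prop :=
  ∀ (n : ℕ) (a : ℕ → G),
    P {ω | ∀ i < n, g i ω = a i} = ∏ i ∈ Finset.range n, μ (a i)

/-- **Lemma 3.5 (four points estimate).** -/
theorem four_points_estimate
    {X : Type*} [MetricSpace X] {δ : ℝ} (hδ : 0 ≤ δ) (hX : IsDeltaHyperbolic X δ)
    (C : ℝ) (hC : 0 ≤ C) (w x y z : X)
    (h1 : gromov w y x ≤ C) (h2 : gromov x z y ≤ C + δ)
    (h3 : 2 * C + 2 * δ + 1 ≤ dist x y) :
    gromov w z x ≤ C + δ := by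
  have h := hX w z y x
  have hzy : C + δ < gromov z y x := by
    unfold gromov at h2 ⊢
    rw [dist_comm y x, dist_comm y z] at h2
    linarith
  rcases min_le_iff.mp (sub_le_iff_le_add.mp (h.trans h1)) with hwz | hzy'
  · exact hwz
  · exact absurd hzy' hzy.not_ge

end
end

section
/- Let X be a δ-hyperbolic metric space and let x_0, x_1, …, x_n be a (C,D)-chain in X with D ≥ 2C + 2δ + 1. Then (x_0, x_n)_{x_1} ≤ C + δ, and d(x_0, x_n) ≥ Σ_{i=0}^{n−1} ( d(x_i, x_{i+1}) − (2C + 2δ) ) ≥ n. -/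
open Filter MeasureTheory
open scoped ENNReal NNReal Classical

noncomputable section

/-- `x_0, …, x_n` is a `(C,D)`-chain. -/
def GromovChain {X : Type*} [MetricSpace X] (C D : ℝ) (x : ℕ → X) (n : ℕ) : Prop :=
  (∀ i : ℕ, 0 < i → i < n → gromov (x (i - 1)) (x (i + 1)) (x i) ≤ C) ∧
    ∀ i : ℕ, i < n → D ≤ dist (x i) (x (i + 1))

/-- Dropping the first point of a chain leaves a chain. -/
theorem GromovChain.tail {X : Type*} [MetricSpace X] {C D : ℝ} {x : ℕ → X} {n : ℕ}
    (hx : GromovChain C D x (n + 1)) : GromovChain C D (fun i => x (i + 1)) n := by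
  refine ⟨fun i h0 hi => ?_, fun i hi => hx.2 (i + 1) (by omega)⟩
  have h := hx.1 (i + 1) (by omega) (by omega)
  simpa [Nat.sub_add_cancel (show 1 ≤ i from h0)] using h

theorem gromov_comm {X : Type*} [MetricSpace X] (x z a : X) : gromov x z a = gromov z x a := by
  unfold gromov
  rw [dist_comm x z]
  ring

/-- Exchanging the base point with the first point. -/
theorem gromov_add_gromov {X : Type*} [MetricSpace X] (x z a : X) :
    gromov x z a + gromov a z x = dist x a := by
  unfold gromov
  rw [dist_comm a x]
  ring

theorem dist_eq_add_sub_gromov {X : Type*} [MetricSpace X] (x z a : X) :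
    dist x z = dist x a + dist a z - 2 * gromov x z a := by
  unfold gromov
  rw [dist_comm a x]
  ring

theorem GromovChain.gromov_le {X : Type*} [MetricSpace X] {δ C D : ℝ} (hδ : 0 ≤ δ)
    (hX : IsDeltaHyperbolic X δ) (hC : 0 ≤ C) (hD : 2 * C + 2 * δ + 1 ≤ D) {n : ℕ} (hn : 1 ≤ n)
    {x : ℕ → X} (hx : GromovChain C D x n) : gromov (x 0) (x n) (x 1) ≤ C + δ := by
  induction n, hn using Nat.le_induction generalizing x with
  | base =>
    have h : gromov (x 0) (x 1) (x 1) = 0 := by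
      simp [gromov, dist_comm]
    linarith
  | succ n hn ih =>
    have htail : gromov (x 1) (x (n + 1)) (x 2) ≤ C + δ := ih hx.tail
    have hturn : gromov (x 0) (x 2) (x 1) ≤ C := hx.1 1 one_pos (by omega)
    have hlen : D ≤ dist (x 1) (x 2) := hx.2 1 (by omega)
    have hsum := gromov_add_gromov (x 1) (x (n + 1)) (x 2)
    have hcomm := gromov_comm (x (n + 1)) (x 2) (x 1)
    have hmin := hX (x 0) (x (n + 1)) (x 2) (x 1)
    rcases min_choice (gromov (x 0) (x (n + 1)) (x 1)) (gromov (x (n + 1)) (x 2) (x 1))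
      with h | h <;> rw [h] at hmin <;> linarith

theorem GromovChain.sum_le_dist {X : Type*} [MetricSpace X] {δ C D : ℝ} (hδ : 0 ≤ δ)
    (hX : IsDeltaHyperbolic X δ) (hC : 0 ≤ C) (hD : 2 * C + 2 * δ + 1 ≤ D) {n : ℕ}
    {x : ℕ → X} (hx : GromovChain C D x n) :
    ∑ i ∈ Finset.range n, (dist (x i) (x (i + 1)) - (2 * C + 2 * δ)) ≤ dist (x 0) (x n) := by
  induction n generalizing x with
  | zero => simp
  | succ n ih =>
    have htail := ih hx.tail
    have hgromov := hx.gromov_le hδ hX hC hD (by omega)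
    have hdist := dist_eq_add_sub_gromov (x 0) (x (n + 1)) (x 1)
    rw [Finset.sum_range_succ']
    simp only [zero_add] at htail ⊢
    linarith

theorem GromovChain.le_sum {X : Type*} [MetricSpace X] {δ C D : ℝ}
    (hD : 2 * C + 2 * δ + 1 ≤ D) {n : ℕ} {x : ℕ → X} (hx : GromovChain C D x n) :
    (n : ℝ) ≤ ∑ i ∈ Finset.range n, (dist (x i) (x (i + 1)) - (2 * C + 2 * δ)) := by
  have h := Finset.card_nsmul_le_sum (Finset.range n)
    (fun i => dist (x i) (x (i + 1)) - (2 * C + 2 * δ)) 1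
    fun i hi => by linarith [hx.2 i (Finset.mem_range.mp hi)]
  simpa using h

/-- **Lemma 3.6 (chains progress linearly).** -/
theorem chain_estimate
    {X : Type*} [MetricSpace X] {δ : ℝ} (hδ : 0 ≤ δ) (hX : IsDeltaHyperbolic X δ)
    (C D : ℝ) (hC : 0 ≤ C) (hD : 2 * C + 2 * δ + 1 ≤ D)
    (n : ℕ) (hn : 1 ≤ n) (x : ℕ → X) (hx : GromovChain C D x n) :
    gromov (x 0) (x n) (x 1) ≤ C + δ ∧
    (∑ i ∈ Finset.range n, (dist (x i) (x (i + 1)) - (2 * C + 2 * δ))) ≤ dist (x 0) (x n) ∧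
    (n : ℝ) ≤ ∑ i ∈ Finset.range n, (dist (x i) (x (i + 1)) - (2 * C + 2 * δ)) :=
  ⟨hx.gromov_le hδ hX hC hD hn, hx.sum_le_dist hδ hX hC hD, hx.le_sum hD⟩

end
end

section
/- Let X be a δ-hyperbolic metric space with basepoint o and let C > 0. Let (x_n) be a sequence in X with d(o, x_n) → ∞, and let (y_p) be a sequence in X such that for every n, one has y_p ∈ S_o(x_n; C) for all sufficiently large p. Then (y_p, y_q)_o → ∞ as p, q → ∞, i.e. the sequence (y_p) converges at infinity. -/
open Filter MeasureTheory
open scoped ENNReal NNReal Classical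

noncomputable section

/-- The `C`-shadow of `x` seen from `o`: the set of `y` with `(y, o)_x ≤ C`. -/
def shadow {X : Type*} [MetricSpace X] (o x : X) (C : ℝ) : Set X :=
  {y | gromov y o x ≤ C}

/-- A point in the `C`-shadow of `x` has Gromov product with `x` at least `d(o, x) - C`. -/
theorem dist_sub_le_gromov_of_mem_shadow {X : Type*} [MetricSpace X] {o x y : X} {C : ℝ}
    (hy : y ∈ shadow o x C) : dist o x - C ≤ gromov y x o := by
  have h : gromov y o x ≤ C := hy
  unfold gromov at h ⊢
  linarith [dist_comm o x, dist_comm o y, dist_comm x y]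

/-- **Lemma 3.2 (sequences eventually in shadows of far away points converge at infinity).** -/
theorem convergence_of_members_of_shadows
    {X : Type*} [MetricSpace X] {δ : ℝ} (hδ : 0 ≤ δ) (hX : IsDeltaHyperbolic X δ)
    (o : X) (C : ℝ) (hC : 0 < C)
    (x : ℕ → X) (hx : Tendsto (fun n => dist o (x n)) atTop atTop)
    (y : ℕ → X) (hy : ∀ n : ℕ, ∀ᶠ p in atTop, y p ∈ shadow o (x n) C) :
    Tendsto (fun pq : ℕ × ℕ => gromov (y pq.1) (y pq.2) o) atTop atTop := by
  refine tendsto_atTop.2 fun M => ?_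
  obtain ⟨n, hn⟩ := (hx.eventually_ge_atTop (M + C + δ)).exists
  rw [← prod_atTop_atTop_eq]
  filter_upwards [(hy n).prod_mk (hy n)] with pq ⟨hp, hq⟩
  have h₁ := dist_sub_le_gromov_of_mem_shadow hp
  have h₂ := dist_sub_le_gromov_of_mem_shadow hq
  have h₃ : gromov (x n) (y pq.2) o = gromov (y pq.2) (x n) o := by
    unfold gromov
    rw [dist_comm (x n), add_comm (dist o (x n))]
  have h₄ := hX (y pq.1) (x n) (y pq.2) o
  have h₅ : M + δ ≤ min (gromov (y pq.1) (x n) o) (gromov (x n) (y pq.2) o) :=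
    le_min (by linarith) (by linarith)
  linarith

end
end

section
/- Let X be a δ-hyperbolic metric space, let C ≥ 0 and y, y⁺, z ∈ X. If z belongs to the C-chain-shadow of y⁺ seen from y, then (y, z)_{y⁺} ≤ 2C + δ and d(y, z) ≥ d(y, y⁺) − 2C − δ. -/
open Filter MeasureTheory
open scoped ENNReal NNReal Classical

noncomputable section

/-- `z` belongs to the `C`-chain-shadow of `y⁺` seen from `y`: there is a
`(C, 2C+2δ+1)`-chain from `y` to `z` whose first jump points towards `y⁺`. -/
def InChainShadow {X : Type*} [MetricSpace X] (δ : ℝ) (y yp z : X) (C : ℝ) : Prop :=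
  ∃ n : ℕ, 1 ≤ n ∧ ∃ x : ℕ → X, x 0 = y ∧ x n = z ∧
    GromovChain C (2 * C + 2 * δ + 1) x n ∧ gromov (x 0) (x 1) yp ≤ C

/-- Seen from `x (i + 1)`, the points `x i` and the endpoint `x (i + 1 + k)` of a chain have
Gromov product at most `C + δ`, and the endpoint is at least as far from `x i` as `x (i + 1)`. -/
lemma GromovChain.gromov_le_and_dist_le {X : Type*} [MetricSpace X] {δ C : ℝ} (hδ : 0 ≤ δ)
    (hX : IsDeltaHyperbolic X δ) (hC : 0 ≤ C) {x : ℕ → X} {n : ℕ}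
    (hx : GromovChain C (2 * C + 2 * δ + 1) x n) (k i : ℕ) (hi : i + 1 + k = n) :
    gromov (x i) (x n) (x (i + 1)) ≤ C + δ ∧ dist (x i) (x (i + 1)) ≤ dist (x i) (x n) := by
  induction k generalizing i with
  | zero =>
    obtain rfl : i + 1 = n := hi
    simp only [gromov, dist_self, dist_comm (x (i + 1)) (x i), le_refl, and_true]
    linarith
  | succ k ih =>
    obtain ⟨hprod, hdist⟩ := ih (i + 1) (by omega)
    have hturn : gromov (x i) (x (i + 1 + 1)) (x (i + 1)) ≤ C :=
      hx.1 (i + 1) (by omega) (by omega)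
    have hjump := hx.2 (i + 1) (by omega)
    have hyp := hX (x i) (x n) (x (i + 1 + 1)) (x (i + 1))
    have hfar : C + δ < gromov (x n) (x (i + 1 + 1)) (x (i + 1)) := by
      simp only [gromov, dist_comm (x n), dist_comm (x (i + 1 + 1)) (x (i + 1))] at hprod ⊢
      linarith
    have hle : gromov (x i) (x n) (x (i + 1)) ≤ C + δ := by
      rcases min_choice (gromov (x i) (x n) (x (i + 1)))
        (gromov (x n) (x (i + 1 + 1)) (x (i + 1))) with h | h <;> rw [h] at hyp <;> linarith
    refine ⟨hle, ?_⟩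
    simp only [gromov, dist_comm (x (i + 1)) (x i)] at hle
    linarith

/-- **Lemma 3.8 (chain-shadows are comparable to shadows).** -/
theorem chain_shadow_estimate
    {X : Type*} [MetricSpace X] {δ : ℝ} (hδ : 0 ≤ δ) (hX : IsDeltaHyperbolic X δ)
    (C : ℝ) (hC : 0 ≤ C) (y yp z : X) (h : InChainShadow δ y yp z C) :
    gromov y z yp ≤ 2 * C + δ ∧ dist y yp - 2 * C - δ ≤ dist y z := by
  obtain ⟨n, hn, x, rfl, rfl, hx, hyp⟩ := h
  obtain ⟨hprod, hdist⟩ := hx.gromov_le_and_dist_le hδ hX hC (n - 1) 0 (by omega)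
  have htri := dist_triangle yp (x 1) (x n)
  simp only [gromov, zero_add, dist_comm (x 1) (x 0), dist_comm yp (x 0)] at *
  have hnonneg : 0 ≤ dist yp (x 1) := dist_nonneg
  constructor <;> linarith

end
end
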